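/- arXiv:1205.2051 — 3 statements merged into one kernel-verified Lean document; each statement's English description precedes it below -/
import Mathlib

section
/- Let Π be a graph problem and T:ℕ×ℕ→ℕ. If there is an algorithm 𝒜∈Multiset (a sequence of distributed state machines, each in the class Multiset) that solves Π in time T, then there is an algorithm ℬ∈Set that solves Π in time T+O(Δ); more precisely, ℬ solves Π in time T'(Δ,n)=T(Δ,n)+2Δ+O(1). -/
namespace Weak

/-- The degree of a vertex. -/
noncomputable def deg {n : ℕ} (G : SimpleGraph (Fin n)) (v : Fin n) : ℕ :=
  Nat.card {u : Fin n // G.Adj v u}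

/-- A port of a graph: a pair (v, i) with i ∈ [deg v]. -/
abbrev Port {n : ℕ} (G : SimpleGraph (Fin n)) : Type := Σ v : Fin n, Fin (deg G v)

/-- A port numbering: a bijection on ports with A(p) = A(G). -/
structure PortNumbering {n : ℕ} (G : SimpleGraph (Fin n)) where
  p : Port G ≃ Port G
  adj : ∀ u v : Fin n, (∃ i : Fin (deg G u), (p ⟨u, i⟩).1 = v) ↔ G.Adj u v

/-- A consistent port numbering is an involution. -/
def PortNumbering.Consistent {n : ℕ} {G : SimpleGraph (Fin n)} (pn : PortNumbering G) : Prop :=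
  ∀ q : Port G, pn.p (pn.p q) = q

/-- A distributed state machine for F(Δ), with stopping states Y. -/
structure DSM (Y : Type) (Δ : ℕ) where
  Z : Type
  z₀ : Fin (Δ + 1) → Y ⊕ Z
  M : Type
  m₀ : M
  μ : Z → Fin Δ → M
  δ : Z → (Fin Δ → M) → Y ⊕ Z

namespace DSM

variable {Y : Type} {Δ : ℕ}

/-- μ extended to stopping states: a stopped node sends the dummy message. -/
def μ' (A : DSM Y Δ) : Y ⊕ A.Z → Fin Δ → A.M
  | Sum.inl _ => fun _ => A.m₀
  | Sum.inr z => A.μ z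

/-- δ extended to stopping states: a stopped node no longer changes state. -/
def δ' (A : DSM Y Δ) : Y ⊕ A.Z → (Fin Δ → A.M) → Y ⊕ A.Z
  | Sum.inl y, _ => Sum.inl y
  | Sum.inr z, m => A.δ z m

/-- Machines whose transition depends only on the multiset of received messages. -/
def InMultiset (A : DSM Y Δ) : Prop :=
  ∀ (z : A.Z) (a b : Fin Δ → A.M),
    (List.ofFn a : Multiset A.M) = (List.ofFn b : Multiset A.M) → A.δ z a = A.δ z b

/-- Machines whose transition depends only on the set of received messages. -/
def InSet (A : DSM Y Δ) : Prop :=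
  ∀ (z : A.Z) (a b : Fin Δ → A.M), Set.range a = Set.range b → A.δ z a = A.δ z b

/-- Machines that send the same message to all ports. -/
def InBroadcast (A : DSM Y Δ) : Prop :=
  ∀ (z : A.Z) (i j : Fin Δ), A.μ z i = A.μ z j

end DSM

/-- The execution of a machine in (G, p): the state of node u at time t. -/
noncomputable def exec {Y : Type} {Δ n : ℕ} (A : DSM Y Δ) (G : SimpleGraph (Fin n))
    (hG : ∀ v, deg G v ≤ Δ) (pn : PortNumbering G) : ℕ → Fin n → Y ⊕ A.Z
  | 0, u => A.z₀ ⟨deg G u, Nat.lt_succ_of_le (hG u)⟩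
  | t + 1, u =>
      A.δ' (exec A G hG pn t u) fun k =>
        if h : (k : ℕ) < deg G u then
          A.μ' (exec A G hG pn t (pn.p.symm ⟨u, ⟨(k : ℕ), h⟩⟩).1)
            ⟨((pn.p.symm ⟨u, ⟨(k : ℕ), h⟩⟩).2 : ℕ),
              lt_of_lt_of_le (pn.p.symm ⟨u, ⟨(k : ℕ), h⟩⟩).2.isLt (hG _)⟩
        else A.m₀

/-- A graph problem: for each graph, a set of admissible outputs. -/
abbrev GraphProblem (Y : Type) : Type :=
  ∀ n : ℕ, SimpleGraph (Fin n) → Set ((Fin n) → Y)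

/-- A sequence of machines solves a problem in time T. -/
def SolvesInTime {Y : Type} (A : ∀ Δ : ℕ, DSM Y Δ) (P : GraphProblem Y)
    (T : ℕ → ℕ → ℕ) : Prop :=
  ∀ (Δ n : ℕ) (G : SimpleGraph (Fin n)) (hG : ∀ v, deg G v ≤ Δ) (pn : PortNumbering G),
    ∃ S ∈ P n G, ∀ u, exec (A Δ) G hG pn (T Δ n) u = Sum.inl (S u)

/-- A sequence of machines solves a problem in time T assuming consistency. -/
def SolvesInTimeConsistent {Y : Type} (A : ∀ Δ : ℕ, DSM Y Δ) (P : GraphProblem Y)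
    (T : ℕ → ℕ → ℕ) : Prop :=
  ∀ (Δ n : ℕ) (G : SimpleGraph (Fin n)) (hG : ∀ v, deg G v ≤ Δ) (pn : PortNumbering G),
    pn.Consistent →
    ∃ S ∈ P n G, ∀ u, exec (A Δ) G hG pn (T Δ n) u = Sum.inl (S u)

/-- Problem class VV. -/
def VV {Y : Type} (P : GraphProblem Y) : Prop :=
  ∃ A : ∀ Δ : ℕ, DSM Y Δ, ∃ T, SolvesInTime A P T

/-- Problem class MV. -/
def MV {Y : Type} (P : GraphProblem Y) : Prop :=
  ∃ A : ∀ Δ : ℕ, DSM Y Δ, (∀ Δ, (A Δ).InMultiset) ∧ ∃ T, SolvesInTime A P T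

/-- Problem class SV. -/
def SV {Y : Type} (P : GraphProblem Y) : Prop :=
  ∃ A : ∀ Δ : ℕ, DSM Y Δ, (∀ Δ, (A Δ).InSet) ∧ ∃ T, SolvesInTime A P T

/-- Problem class VB. -/
def VB {Y : Type} (P : GraphProblem Y) : Prop :=
  ∃ A : ∀ Δ : ℕ, DSM Y Δ, (∀ Δ, (A Δ).InBroadcast) ∧ ∃ T, SolvesInTime A P T

/-- Problem class MB. -/
def MB {Y : Type} (P : GraphProblem Y) : Prop :=
  ∃ A : ∀ Δ : ℕ, DSM Y Δ, (∀ Δ, (A Δ).InMultiset ∧ (A Δ).InBroadcast) ∧ ∃ T, SolvesInTime A P T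

/-- Problem class SB. -/
def SB {Y : Type} (P : GraphProblem Y) : Prop :=
  ∃ A : ∀ Δ : ℕ, DSM Y Δ, (∀ Δ, (A Δ).InSet ∧ (A Δ).InBroadcast) ∧ ∃ T, SolvesInTime A P T

/-- Problem class VVc. -/
def VVc {Y : Type} (P : GraphProblem Y) : Prop :=
  ∃ A : ∀ Δ : ℕ, DSM Y Δ, ∃ T, SolvesInTimeConsistent A P T

/-- Constant-time problem class VV(1). -/
def VV1 {Y : Type} (P : GraphProblem Y) : Prop :=
  ∃ A : ∀ Δ : ℕ, DSM Y Δ, ∃ T' : ℕ → ℕ, SolvesInTime A P fun Δ _ => T' Δ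

/-- Constant-time problem class MV(1). -/
def MV1 {Y : Type} (P : GraphProblem Y) : Prop :=
  ∃ A : ∀ Δ : ℕ, DSM Y Δ, (∀ Δ, (A Δ).InMultiset) ∧
    ∃ T' : ℕ → ℕ, SolvesInTime A P fun Δ _ => T' Δ

/-- Constant-time problem class SV(1). -/
def SV1 {Y : Type} (P : GraphProblem Y) : Prop :=
  ∃ A : ∀ Δ : ℕ, DSM Y Δ, (∀ Δ, (A Δ).InSet) ∧
    ∃ T' : ℕ → ℕ, SolvesInTime A P fun Δ _ => T' Δ

/-- Constant-time problem class VB(1). -/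
def VB1 {Y : Type} (P : GraphProblem Y) : Prop :=
  ∃ A : ∀ Δ : ℕ, DSM Y Δ, (∀ Δ, (A Δ).InBroadcast) ∧
    ∃ T' : ℕ → ℕ, SolvesInTime A P fun Δ _ => T' Δ

/-- Constant-time problem class MB(1). -/
def MB1 {Y : Type} (P : GraphProblem Y) : Prop :=
  ∃ A : ∀ Δ : ℕ, DSM Y Δ, (∀ Δ, (A Δ).InMultiset ∧ (A Δ).InBroadcast) ∧
    ∃ T' : ℕ → ℕ, SolvesInTime A P fun Δ _ => T' Δ

/-- Constant-time problem class SB(1). -/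
def SB1 {Y : Type} (P : GraphProblem Y) : Prop :=
  ∃ A : ∀ Δ : ℕ, DSM Y Δ, (∀ Δ, (A Δ).InSet ∧ (A Δ).InBroadcast) ∧
    ∃ T' : ℕ → ℕ, SolvesInTime A P fun Δ _ => T' Δ

/-- Constant-time problem class VVc(1). -/
def VVc1 {Y : Type} (P : GraphProblem Y) : Prop :=
  ∃ A : ∀ Δ : ℕ, DSM Y Δ, ∃ T' : ℕ → ℕ, SolvesInTimeConsistent A P fun Δ _ => T' Δ

end Weak

namespace Weak

open Finset

/-- Two families with the same image, both injective away from a default value `x`, are equal as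
multisets. -/
theorem map_univ_eq_of_image_eq {ι α : Type*} [Fintype ι] [DecidableEq α] {f g : ι → α} {x : α}
    (himage : univ.image f = univ.image g)
    (hf : ∀ i j, f i = f j → f i ≠ x → i = j) (hg : ∀ i j, g i = g j → g i ≠ x → i = j) :
    (univ : Finset ι).val.map f = (univ : Finset ι).val.map g := by
  have nodup : ∀ h : ι → α, (∀ i j, h i = h j → h i ≠ x → i = j) →
      (((univ : Finset ι).val.map h).filter (fun y => ¬ y = x)).Nodup := by
    intro h hh
    rw [Multiset.filter_map]
    refine Multiset.Nodup.map_on ?_ (univ.nodup.filter _)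
    intro i hi j _ hij
    exact hh i j hij (Multiset.mem_filter.1 hi).2
  have mem : ∀ y, (∃ i, f i = y) ↔ ∃ i, g i = y := by
    intro y
    simpa using congrArg (y ∈ ·) himage
  have hne : ((univ : Finset ι).val.map f).filter (fun y => ¬ y = x) =
      ((univ : Finset ι).val.map g).filter (fun y => ¬ y = x) := by
    rw [Multiset.Nodup.ext (nodup f hf) (nodup g hg)]
    intro y
    simp [mem y]
  have hcard := congrArg Multiset.card (Multiset.filter_add_not (· = x) (univ.val.map f))
  have hcard' := congrArg Multiset.card (Multiset.filter_add_not (· = x) (univ.val.map g))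
  rw [← Multiset.filter_add_not (· = x) (univ.val.map f),
    ← Multiset.filter_add_not (· = x) (univ.val.map g), hne]
  congr 1
  rw [Multiset.filter_eq', Multiset.filter_eq'] at *
  congr 1
  simp only [Multiset.card_add, Multiset.card_replicate, Multiset.card_map, hne] at hcard hcard'
  omega

/-- If colours are refined by the set of pairs (neighbour's colour, neighbour's port towards us),
then two neighbours of `u` with equal ports towards `u` that still share a colour after `2 * k`
refinements witness at least `k + 2` neighbours of `u`. -/
theorem card_neighbors_of_color_eq {V : Type*} [Fintype V] [DecidableEq V] (G : SimpleGraph V)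
    [DecidableRel G.Adj] {π : V → V → ℕ}
    (hπ : ∀ v x y, G.Adj v x → G.Adj v y → π v x = π v y → x = y) {β : ℕ → V → ℕ}
    (hpred : ∀ t v w, β (t + 1) v = β (t + 1) w → β t v = β t w)
    (hnbr : ∀ t v w, β (t + 1) v = β (t + 1) w → ∀ x, G.Adj x v →
      ∃ y, G.Adj y w ∧ β t y = β t x ∧ π y w = π x v)
    {u v w : V} (hv : G.Adj u v) (hw : G.Adj u w) (hvw : v ≠ w) (hport : π v u = π w u)
    (k s : ℕ) (h : β (s + 2 * k) v = β (s + 2 * k) w) :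
    k + 2 ≤ #{x | G.Adj u x ∧ β s x = β s v} := by
  induction k generalizing s with
  | zero =>
    rw [zero_add, ← card_pair hvw]
    apply card_le_card
    intro x hx
    rcases mem_insert.1 hx with rfl | hx
    · simpa using hv
    · rw [mem_singleton] at hx
      subst hx
      simpa using ⟨hw, h.symm⟩
  | succ k ih =>
    have hmono : ∀ d, β (s + d) v = β (s + d) w → β s v = β s w := by
      intro d
      induction d with
      | zero => exact id
      | succ d hd => exact fun hd' => hd (hpred _ _ _ hd')
    have hsw := hmono _ h
    have hX := ih (s + 2) (by rwa [show s + 2 + 2 * k = s + 2 * (k + 1) by ring])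
    set X : Finset V := {x | G.Adj u x ∧ β (s + 2) x = β (s + 2) v} with hXdef
    set Y : Finset V := {y | G.Adj v y ∧ β (s + 1) y = β (s + 1) u} with hYdef
    set X' : Finset V := {x | G.Adj u x ∧ β s x = β s v} with hXdef'
    have hXcard : #(X.image (π u)) = #X := by
      refine card_image_of_injOn fun x hx y hy hxy => hπ u x y ?_ ?_ hxy
      · exact (mem_filter.1 hx).2.1
      · exact (mem_filter.1 hy).2.1
    have hYcard : #(Y.image (π v)) = #Y := by
      refine card_image_of_injOn fun x hx y hy hxy => hπ v x y ?_ ?_ hxy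
      · exact (mem_filter.1 hx).2.1
      · exact (mem_filter.1 hy).2.1
    have hXY : X.image (π u) ⊆ Y.image (π · v) := by
      intro q hq
      obtain ⟨x, hx, rfl⟩ := mem_image.1 hq
      obtain ⟨hux, hxv⟩ := (mem_filter.1 hx).2
      obtain ⟨y, hy, hyβ, hyπ⟩ := hnbr (s + 1) x v hxv u hux
      exact mem_image.2 ⟨y, by simpa [hYdef] using ⟨hy.symm, hyβ⟩, hyπ⟩
    have hYX : Y.image (π v) ⊆ (X'.erase w).image (π · u) := by
      intro j hj
      obtain ⟨y, hy, rfl⟩ := mem_image.1 hj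
      obtain ⟨hvy, hyu⟩ := (mem_filter.1 hy).2
      obtain ⟨x, hx, hxβ, hxπ⟩ := hnbr s y u hyu v hvy
      by_cases hxw : x = w
      · subst hxw
        exact mem_image.2 ⟨v, by simpa [hXdef', hvw] using hv, hport.trans hxπ⟩
      · exact mem_image.2 ⟨x, by simpa [hXdef', hxw] using ⟨hx.symm, hxβ⟩, hxπ⟩
    have hwX : w ∈ X' := by simpa [hXdef'] using ⟨hw, hsw.symm⟩
    have h1 := (card_le_card hXY).trans card_image_le
    have h2 := (card_le_card hYX).trans card_image_le
    have h3 := card_erase_add_one hwX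
    omega

section Ports

variable {n : ℕ} {G : SimpleGraph (Fin n)} (pn : PortNumbering G)

theorem PortNumbering.target_injective (v : Fin n) :
    Function.Injective fun i : Fin (deg G v) => (pn.p ⟨v, i⟩).1 := by
  let f : Fin (deg G v) → {u : Fin n // G.Adj v u} :=
    fun i => ⟨(pn.p ⟨v, i⟩).1, (pn.adj v _).1 ⟨i, rfl⟩⟩
  have hf : Function.Surjective f := by
    rintro ⟨u, hu⟩
    obtain ⟨i, hi⟩ := (pn.adj v u).2 hu
    exact ⟨i, Subtype.ext hi⟩
  have hbij : Function.Bijective f := by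
    rw [Nat.bijective_iff_surjective_and_card]
    exact ⟨hf, by simp [deg]⟩
  intro i j hij
  exact hbij.1 (Subtype.ext hij)

/-- The port of the neighbour that sends to the `k`-th port of `u`. -/
def PortNumbering.source (u : Fin n) (k : Fin (deg G u)) : Port G := pn.p.symm ⟨u, k⟩

theorem PortNumbering.target_source (u : Fin n) (k : Fin (deg G u)) :
    (pn.p ⟨(pn.source u k).1, (pn.source u k).2⟩).1 = u := by
  simp [source]

theorem PortNumbering.source_adj (u : Fin n) (k : Fin (deg G u)) :
    G.Adj (pn.source u k).1 u :=
  (pn.adj _ u).1 ⟨_, pn.target_source u k⟩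

theorem PortNumbering.source_injective (u : Fin n) :
    Function.Injective fun k : Fin (deg G u) => (pn.source u k).1 := by
  intro k l hkl
  have hsource : pn.source u k = pn.source u l := by
    have hk := pn.target_source u k
    have hl := pn.target_source u l
    dsimp only at hkl
    generalize pn.source u k = a at *
    generalize pn.source u l = b at *
    obtain ⟨v, i⟩ := a
    obtain ⟨w, j⟩ := b
    obtain rfl : v = w := hkl
    obtain rfl : i = j := pn.target_injective v (hk.trans hl.symm)
    rfl
  simpa [source] using hsource

open Classical in
/-- The port of `v` that leads to its neighbour `u`. -/
noncomputable def PortNumbering.portTo (v u : Fin n) : ℕ :=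
  if h : ∃ i : Fin (deg G v), (pn.p ⟨v, i⟩).1 = u then (h.choose : ℕ) else 0

theorem PortNumbering.portTo_target (v : Fin n) (i : Fin (deg G v)) :
    pn.portTo v (pn.p ⟨v, i⟩).1 = i := by
  have h : ∃ j : Fin (deg G v), (pn.p ⟨v, j⟩).1 = (pn.p ⟨v, i⟩).1 := ⟨i, rfl⟩
  rw [portTo, dif_pos h, pn.target_injective v h.choose_spec]

theorem PortNumbering.portTo_source (u : Fin n) (k : Fin (deg G u)) :
    pn.portTo (pn.source u k).1 u = (pn.source u k).2 := by
  have h := pn.portTo_target _ (pn.source u k).2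
  rwa [pn.target_source u k] at h

theorem PortNumbering.portTo_injOn (v x y : Fin n) (hx : G.Adj v x) (hy : G.Adj v y)
    (hxy : pn.portTo v x = pn.portTo v y) : x = y := by
  obtain ⟨i, rfl⟩ := (pn.adj v x).2 hx
  obtain ⟨j, rfl⟩ := (pn.adj v y).2 hy
  rw [portTo_target, portTo_target] at hxy
  rw [Fin.ext hxy]

theorem PortNumbering.exists_source_of_adj {x v : Fin n} (h : G.Adj x v) :
    ∃ k, (pn.source v k).1 = x := by
  obtain ⟨i, rfl⟩ := (pn.adj x v).2 h
  exact ⟨(pn.p ⟨x, i⟩).2, by simp [source]⟩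

/-- Colours encoding the sets of (colour, port) pairs received so far. -/
noncomputable def PortNumbering.color : ℕ → Fin n → ℕ
  | 0, _ => 0
  | t + 1, v => Encodable.encode (color t v, univ.image fun k : Fin (deg G v) =>
      (color t (pn.source v k).1, ((pn.source v k).2 : ℕ)))

/-- After `2 * Δ` rounds, the pair (colour, port) identifies the sender among all messages
received by a node. -/
theorem PortNumbering.color_separates {Δ : ℕ} (hG : ∀ v, deg G v ≤ Δ) (u : Fin n)
    (k l : Fin (deg G u))
    (hcolor : pn.color (2 * Δ) (pn.source u k).1 = pn.color (2 * Δ) (pn.source u l).1)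
    (hport : ((pn.source u k).2 : ℕ) = (pn.source u l).2) : k = l := by
  classical
  by_contra hkl
  have hne : (pn.source u k).1 ≠ (pn.source u l).1 := fun h => hkl (pn.source_injective u h)
  rw [← portTo_source, ← portTo_source] at hport
  have hcard := card_neighbors_of_color_eq G pn.portTo_injOn (β := pn.color)
    (fun t v w h => (Prod.ext_iff.1 (Encodable.encode_injective h)).1)
    (by
      intro t v w h x hx
      have hset := (Prod.ext_iff.1 (Encodable.encode_injective h)).2
      obtain ⟨i, rfl⟩ := pn.exists_source_of_adj hx
      have hmem := mem_image_of_mem (fun k : Fin (deg G v) =>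
        (pn.color t (pn.source v k).1, ((pn.source v k).2 : ℕ))) (mem_univ i)
      dsimp only at hset
      rw [hset] at hmem
      obtain ⟨j, -, hj⟩ := mem_image.1 hmem
      obtain ⟨hj1, hj2⟩ := Prod.ext_iff.1 hj
      refine ⟨_, pn.source_adj w j, hj1, ?_⟩
      rw [portTo_source, portTo_source]
      exact hj2)
    (pn.source_adj u k).symm (pn.source_adj u l).symm hne hport Δ 0 (by rwa [zero_add])
  have hdeg : #{x | G.Adj u x} ≤ Δ := by
    have := hG u
    rwa [deg, Nat.card_eq_fintype_card, Fintype.card_subtype] at this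
  have hle : #{x | G.Adj u x ∧ pn.color 0 x = pn.color 0 (pn.source u k).1} ≤
      #{x | G.Adj u x} :=
    card_le_card fun x hx => by
      simp only [mem_filter, mem_univ, true_and] at hx ⊢
      exact hx.1
  omega

end Ports

namespace DSM

variable {Y : Type} {Δ : ℕ} (A : DSM Y Δ)

/-- Messages of the simulating machine: sender's colour, sender's port and a message of `A`. -/
abbrev SimMsg : Type := Option (ℕ × ℕ × A.M)

/-- The message of `A` carried by a message of the simulating machine. -/
def payload (m : A.SimMsg) : A.M := m.elim A.m₀ fun m => m.2.2

/-- A vector is separated if no proper message occurs in it twice. -/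
def Separated (a : Fin Δ → A.SimMsg) : Prop := ∀ i j, a i = a j → a i ≠ none → i = j

open Classical in
/-- A vector of messages of `A`, obtained from the set of received messages. -/
noncomputable def reconstruct (R : Finset A.SimMsg) : Fin Δ → A.M :=
  if h : ∃ a : Fin Δ → A.SimMsg, univ.image a = R ∧ A.Separated a then A.payload ∘ h.choose
  else fun _ => A.m₀

open Classical in
theorem reconstruct_image (a : Fin Δ → A.SimMsg) (ha : A.Separated a) :
    (List.ofFn (A.reconstruct (univ.image a)) : Multiset A.M) =
      (List.ofFn (A.payload ∘ a) : Multiset A.M) := by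
  have h : ∃ a' : Fin Δ → A.SimMsg, univ.image a' = univ.image a ∧ A.Separated a' := ⟨a, rfl, ha⟩
  rw [reconstruct, dif_pos h, ← Fin.univ_val_map, ← Fin.univ_val_map, ← Multiset.map_map,
    ← Multiset.map_map, map_univ_eq_of_image_eq h.choose_spec.1 h.choose_spec.2 ha]

open Classical in
/-- The set of (colour, port) pairs occurring in a set of messages. -/
noncomputable def keys (R : Finset A.SimMsg) : Finset (ℕ × ℕ) :=
  R.eraseNone.image fun m => (m.1, m.2.1)

open Classical in
/-- One step of the simulating machine: it refines colours for `2 * Δ` rounds, and then runs `A`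
with every message tagged by the sender's colour and port. -/
noncomputable def simStep (z : ℕ × ℕ × (Y ⊕ A.Z)) (a : Fin Δ → A.SimMsg) :
    Y ⊕ (ℕ × ℕ × (Y ⊕ A.Z)) :=
  if z.1 < 2 * Δ then
    Sum.inr (z.1 + 1, Encodable.encode (z.2.1, A.keys (univ.image a)), z.2.2)
  else
    (A.δ' z.2.2 (A.reconstruct (univ.image a))).map id fun z' => (z.1, z.2.1, Sum.inr z')

/-- The `Set` machine simulating `A`. -/
noncomputable abbrev toSet : DSM Y Δ where
  Z := ℕ × ℕ × (Y ⊕ A.Z)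
  z₀ d := Sum.inr (0, 0, A.z₀ d)
  M := A.SimMsg
  m₀ := none
  μ z i := some (z.2.1, i, A.μ' z.2.2 i)
  δ := A.simStep

theorem toSet_inSet : A.toSet.InSet := by
  classical
  intro z (a : Fin Δ → A.SimMsg) (b : Fin Δ → A.SimMsg) hab
  have himage : univ.image a = univ.image b := by
    apply Finset.coe_injective
    simpa using hab
  change A.simStep z a = A.simStep z b
  simp only [simStep, himage]

variable {A}

theorem InMultiset.δ'_eq (hA : A.InMultiset) (x : Y ⊕ A.Z) {a b : Fin Δ → A.M}
    (h : (List.ofFn a : Multiset A.M) = (List.ofFn b : Multiset A.M)) : A.δ' x a = A.δ' x b := by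
  cases x with
  | inl y => rfl
  | inr z => exact hA z a b h

end DSM

section Simulation

variable {Y : Type} {Δ n : ℕ} (A : DSM Y Δ) {G : SimpleGraph (Fin n)}
  (hG : ∀ v, deg G v ≤ Δ) (pn : PortNumbering G)

/-- The vector of messages received when the nodes are in states `x`. -/
noncomputable def received (x : Fin n → Y ⊕ A.Z) (u : Fin n) (k : Fin Δ) : A.M :=
  if h : (k : ℕ) < deg G u then
    A.μ' (x (pn.source u ⟨k, h⟩).1)
      ⟨(pn.source u ⟨k, h⟩).2, (pn.source u ⟨k, h⟩).2.isLt.trans_le (hG _)⟩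
  else A.m₀

theorem exec_succ (t : ℕ) (u : Fin n) :
    exec A G hG pn (t + 1) u =
      A.δ' (exec A G hG pn t u) (received A hG pn (exec A G hG pn t) u) := rfl

theorem exec_toSet_collect (t : ℕ) (ht : t ≤ 2 * Δ) (u : Fin n) :
    exec A.toSet G hG pn t u = Sum.inr (t, pn.color t u, exec A G hG pn 0 u) := by
  classical
  induction t generalizing u with
  | zero => rfl
  | succ t ih =>
    have hlt : t < 2 * Δ := ht
    have hstate := ih hlt.le
    have hkeys : A.keys (univ.image (received A.toSet hG pn (exec A.toSet G hG pn t) u)) =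
        univ.image fun k : Fin (deg G u) =>
          (pn.color t (pn.source u k).1, ((pn.source u k).2 : ℕ)) := by
      ext ⟨c, j⟩
      simp only [DSM.keys, mem_image, mem_univ, true_and, mem_eraseNone, Prod.mk.injEq]
      constructor
      · rintro ⟨m, ⟨k, hk⟩, rfl, rfl⟩
        rw [received] at hk
        split_ifs at hk with h
        · rw [hstate] at hk
          obtain rfl := Option.some.inj hk
          exact ⟨⟨k, h⟩, rfl, rfl⟩
      · rintro ⟨k, rfl, rfl⟩
        refine ⟨(_, _, A.μ' (exec A G hG pn 0 (pn.source u k).1)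
          ⟨(pn.source u k).2, (pn.source u k).2.isLt.trans_le (hG _)⟩),
          ⟨⟨k, k.isLt.trans_le (hG u)⟩, ?_⟩, rfl, rfl⟩
        rw [received, dif_pos k.isLt, hstate]
        rfl
    rw [exec_succ]
    nth_rw 1 [hstate]
    change A.simStep _ _ = _
    simp only [DSM.simStep, PortNumbering.color, if_pos hlt, ← hkeys]

/-- The state of the simulating machine represents the state `x` of the simulated one. -/
def Represents (c : ℕ) (x : Y ⊕ A.Z) (s : Y ⊕ A.toSet.Z) : Prop :=
  s = Sum.inr (2 * Δ, c, x) ∨ ∃ y, x = Sum.inl y ∧ s = Sum.inl y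

theorem payload_μ' {c : ℕ} {x : Y ⊕ A.Z} {s : Y ⊕ A.toSet.Z} (h : Represents A c x s)
    (i : Fin Δ) : A.payload (A.toSet.μ' s i) = A.μ' x i := by
  rcases h with rfl | ⟨y, rfl, rfl⟩ <;> rfl

theorem key_μ' {c : ℕ} {x : Y ⊕ A.Z} {s : Y ⊕ A.toSet.Z} (h : Represents A c x s)
    (i : Fin Δ) : A.toSet.μ' s i = none ∨ A.toSet.μ' s i = some (c, (i : ℕ), A.μ' x i) := by
  rcases h with rfl | ⟨y, rfl, rfl⟩
  · exact Or.inr rfl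
  · exact Or.inl rfl

theorem separated_received {x : Fin n → Y ⊕ A.Z} {s : Fin n → Y ⊕ A.toSet.Z}
    (h : ∀ v, Represents A (pn.color (2 * Δ) v) (x v) (s v)) (u : Fin n) :
    A.Separated (received A.toSet hG pn s u) := by
  have key : ∀ k, received A.toSet hG pn s u k ≠ none → ∃ (hk : (k : ℕ) < deg G u) (m : A.M),
      received A.toSet hG pn s u k = some (pn.color (2 * Δ) (pn.source u ⟨k, hk⟩).1,
        ((pn.source u ⟨k, hk⟩).2 : ℕ), m) := by
    intro k hne
    rw [received] at hne ⊢
    split_ifs at hne ⊢ with hk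
    · rcases key_μ' A (h (pn.source u ⟨k, hk⟩).1)
        ⟨(pn.source u ⟨k, hk⟩).2, (pn.source u ⟨k, hk⟩).2.isLt.trans_le (hG _)⟩ with h0 | h1
      · exact absurd h0 hne
      · exact ⟨hk, _, h1⟩
    · exact absurd rfl hne
  intro i j hij hi
  obtain ⟨hi', m, hm⟩ := key i hi
  obtain ⟨hj', m', hm'⟩ := key j (hij ▸ hi)
  rw [hm, hm'] at hij
  simp only [Option.some.injEq, Prod.mk.injEq] at hij
  have := pn.color_separates hG u _ _ hij.1 hij.2.1
  simpa [Fin.ext_iff] using this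

theorem payload_received {x : Fin n → Y ⊕ A.Z} {s : Fin n → Y ⊕ A.toSet.Z}
    (h : ∀ v, Represents A (pn.color (2 * Δ) v) (x v) (s v)) (u : Fin n) :
    A.payload ∘ received A.toSet hG pn s u = received A hG pn x u := by
  funext k
  by_cases hk : (k : ℕ) < deg G u
  · simpa [received, hk] using payload_μ' A (h _) _
  · simp [received, hk, DSM.payload]

variable {A}

theorem represents_exec (hA : A.InMultiset) (t : ℕ) (u : Fin n) :
    Represents A (pn.color (2 * Δ) u) (exec A G hG pn t u)
      (exec A.toSet G hG pn (2 * Δ + t) u) := by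
  classical
  induction t generalizing u with
  | zero => exact Or.inl (exec_toSet_collect A hG pn _ le_rfl u)
  | succ t ih =>
    rw [← add_assoc, exec_succ, exec_succ]
    have hrec := A.reconstruct_image _ (separated_received A hG pn ih u)
    rw [payload_received A hG pn ih u] at hrec
    rcases ih u with hs | ⟨y, hx, hs⟩
    · rw [hs]
      rw [← hA.δ'_eq _ hrec]
      change Represents A _ _ (A.simStep _ _)
      simp only [DSM.simStep, if_neg (lt_irrefl _)]
      generalize hx : A.δ' (exec A G hG pn t u) _ = x
      cases x with
      | inl y => exact Or.inr ⟨y, rfl, rfl⟩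
      | inr z => exact Or.inl rfl
    · rw [hs, hx]
      exact Or.inr ⟨y, rfl, rfl⟩

theorem exec_toSet_eq_inl (hA : A.InMultiset) {t : ℕ} {u : Fin n} {y : Y}
    (h : exec A G hG pn t u = Sum.inl y) :
    exec A.toSet G hG pn (2 * Δ + t + 1) u = Sum.inl y := by
  rw [exec_succ]
  rcases represents_exec hG pn hA t u with hs | ⟨y', hx, hs⟩
  · rw [hs, h]
    change A.simStep _ _ = _
    simp only [DSM.simStep, if_neg (lt_irrefl _)]
    rfl
  · rw [hs]
    rw [h] at hx
    exact congrArg Sum.inl (Sum.inl.inj hx).symm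

end Simulation

/-- Theorem 3 (Multiset → Set simulation with overhead 2Δ + O(1)). -/
theorem multiset_to_set {Y : Type} [Fintype Y] (P : GraphProblem Y) (T : ℕ → ℕ → ℕ)
    (A : ∀ Δ : ℕ, DSM Y Δ) (hA : ∀ Δ, (A Δ).InMultiset)
    (hsolves : SolvesInTime A P T) :
    ∃ (C : ℕ) (B : ∀ Δ : ℕ, DSM Y Δ), (∀ Δ, (B Δ).InSet) ∧
      SolvesInTime B P (fun Δ n => T Δ n + 2 * Δ + C) := by
  refine ⟨1, fun Δ => (A Δ).toSet, fun Δ => (A Δ).toSet_inSet, ?_⟩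
  intro Δ n G hG pn
  obtain ⟨S, hS, hexec⟩ := hsolves Δ n G hG pn
  refine ⟨S, hS, fun u => ?_⟩
  dsimp only
  rw [add_comm (T Δ n)]
  exact exec_toSet_eq_inl hG pn (hA Δ) (hexec u)

end Weak
end

section
/- Let Π be a graph problem and T:ℕ×ℕ→ℕ. If there is an algorithm 𝒜∈Vector (a sequence of distributed state machines) that solves Π in time T, then there is an algorithm ℬ∈Multiset that solves Π in the same time T. -/
namespace Weak

section Reindexing

variable {α M : Type}

theorem exists_perm_of_map_univ_eq {ι : Type} [Fintype ι] {f g : ι → α}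
    (h : Finset.univ.val.map f = Finset.univ.val.map g) :
    ∃ σ : Equiv.Perm ι, ∀ k, f k = g (σ k) := by
  classical
  have hcard (c : α) : Fintype.card {k // f k = c} = Fintype.card {k // g k = c} := by
    have hc := congrArg (Multiset.count c) h
    simp only [Multiset.count_map, eq_comm (a := c)] at hc
    rw [Fintype.card_subtype, Fintype.card_subtype]
    exact hc
  exact ⟨Equiv.ofFiberEquiv fun c => Fintype.equivOfCardEq (hcard c),
    fun k => (Equiv.ofFiberEquiv_map _ k).symm⟩

/-- A family of histories extending `g` by one step whose multiset of values is `H`;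
it is `g` itself if there is none. -/
noncomputable def extendHistories {d : ℕ} (g : Fin d → List M) (H : Multiset (List M)) :
    Fin d → List M :=
  open Classical in
  if h : ∃ g' : Fin d → List M,
      (∀ k, (g' k).tail = g k) ∧ Finset.univ.val.map g' = H then h.choose else g

theorem extendHistories_spec {d : ℕ} {g f : Fin d → List M}
    (h : Finset.univ.val.map (fun k => (f k).tail) = Finset.univ.val.map g) :
    (∀ k, (extendHistories g (Finset.univ.val.map f) k).tail = g k) ∧
      Finset.univ.val.map (extendHistories g (Finset.univ.val.map f)) = Finset.univ.val.map f := by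
  have hex : ∃ g' : Fin d → List M,
      (∀ k, (g' k).tail = g k) ∧ Finset.univ.val.map g' = Finset.univ.val.map f := by
    obtain ⟨σ, hσ⟩ := exists_perm_of_map_univ_eq h.symm
    refine ⟨f ∘ σ, fun k => (hσ k).symm, ?_⟩
    rw [← Multiset.map_map, Multiset.map_univ_val_equiv]
  rw [extendHistories, dif_pos hex]
  exact hex.choose_spec

/-- The multiset of current histories, given the multiset `G` of previous histories and the
multiset `R` of those current histories that were received: a missing history is extended
by the dummy message. -/
noncomputable def complete (m₀ : M) (G R : Multiset (List M)) : Multiset (List M) :=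
  open Classical in R + (G - R.map List.tail).map (List.cons m₀)

theorem complete_filterMap {ι : Type} (m₀ : M) (f g : ι → List M) (x : ι → Option (List M))
    (htail : ∀ k, (f k).tail = g k)
    (hx : ∀ k, x k = some (f k) ∨ x k = none ∧ f k = m₀ :: g k) (s : Multiset ι) :
    complete m₀ (s.map g) ((s.map x).filterMap id) = s.map f := by
  classical
  obtain ⟨N, hG, hF⟩ : ∃ N : Multiset (List M),
      s.map g = ((s.map x).filterMap id).map List.tail + N ∧
        (s.map x).filterMap id + N.map (List.cons m₀) = s.map f := by
    induction s using Multiset.induction_on with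
    | empty => exact ⟨0, by simp⟩
    | cons k s ih =>
      obtain ⟨N, hG, hF⟩ := ih
      rcases hx k with h | ⟨h, hf⟩
      · refine ⟨N, ?_, ?_⟩
        · simp [Multiset.filterMap_cons_some id (some (f k)) _ rfl, h, hG, htail]
        · simp [Multiset.filterMap_cons_some id (some (f k)) _ rfl, h, ← hF]
      · refine ⟨g k ::ₘ N, ?_, ?_⟩
        · simp [Multiset.filterMap_cons_none (f := id) none _ rfl, h, hG]
        · simp [Multiset.filterMap_cons_none (f := id) none _ rfl, h, hf, ← hF]
  rw [complete, hG, ← hF, add_tsub_cancel_left]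

/-- Extend a vector to length `Δ` by a default value. -/
def pad {d : ℕ} (Δ : ℕ) (a : α) (f : Fin d → α) : Fin Δ → α :=
  fun k => if h : (k : ℕ) < d then f ⟨k, h⟩ else a

theorem filterMap_ofFn_pad_none {d Δ : ℕ} (hd : d ≤ Δ) (f : Fin d → Option α) :
    (List.ofFn (pad Δ none f) : Multiset (Option α)).filterMap id =
      (Finset.univ.val.map f).filterMap id := by
  obtain ⟨e, rfl⟩ := Nat.exists_eq_add_of_le hd
  rw [Fin.univ_val_map, Multiset.filterMap_coe, Multiset.filterMap_coe, List.ofFn_add]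
  simp [pad]

end Reindexing

section Simulation

variable {Y : Type} {Δ n : ℕ}

/-- The values arriving at the ports of `u` when node `v` sends `s v j` to its port `j`. -/
def incoming {α : Type} {G : SimpleGraph (Fin n)} (hG : ∀ v, deg G v ≤ Δ)
    (pn : PortNumbering G) (s : Fin n → Fin Δ → α) (u : Fin n) (k : Fin (deg G u)) : α :=
  s (pn.p.symm ⟨u, k⟩).1
    ⟨((pn.p.symm ⟨u, k⟩).2 : ℕ), lt_of_lt_of_le (pn.p.symm ⟨u, k⟩).2.isLt (hG _)⟩

theorem exec_succ_s4 (A : DSM Y Δ) (G : SimpleGraph (Fin n)) (hG : ∀ v, deg G v ≤ Δ)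
    (pn : PortNumbering G) (t : ℕ) (u : Fin n) :
    exec A G hG pn (t + 1) u = A.δ' (exec A G hG pn t u)
      (pad Δ A.m₀ (incoming hG pn (fun v => A.μ' (exec A G hG pn t v)) u)) :=
  rfl

/-- The same port numbering with the incoming ports of every node permuted. -/
def PortNumbering.permute {G : SimpleGraph (Fin n)} (pn : PortNumbering G)
    (σ : ∀ u, Equiv.Perm (Fin (deg G u))) : PortNumbering G where
  p := pn.p.trans (Equiv.sigmaCongrRight σ).symm
  adj := pn.adj

/-- The multiset machine simulating `A`. A message is the list of all messages `A` has sent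
through the port, the latest one first. A state consists of a state of `A`, an ordered family of
the histories received from the neighbours, and the histories sent. -/
noncomputable def DSM.toMultiset (A : DSM Y Δ) : DSM Y Δ where
  Z := A.Z × (Σ d : ℕ, Fin d → List A.M) × (Fin Δ → List A.M)
  z₀ d := (A.z₀ d).map id fun z => (z, ⟨d, fun _ => []⟩, fun _ => [])
  M := Option (List A.M)
  m₀ := none
  μ z i := some (A.μ z.1 i :: z.2.2 i)
  δ z a :=
    let g := extendHistories z.2.1.2 (complete A.m₀ (Finset.univ.val.map z.2.1.2)
      ((List.ofFn a : Multiset (Option (List A.M))).filterMap id))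
    (A.δ z.1 (pad Δ A.m₀ fun k => (g k).headD A.m₀)).map id
      fun z' => (z', ⟨z.2.1.1, g⟩, fun i => A.μ z.1 i :: z.2.2 i)

theorem DSM.toMultiset_inMultiset (A : DSM Y Δ) : A.toMultiset.InMultiset := by
  intro z a b hab
  simp only [DSM.toMultiset] at hab ⊢
  rw [hab]

/-- A global view of the simulation: the states of all nodes, the histories sent and the ordered
histories received, all of which are recorded also for stopped nodes. -/
structure Config (A : DSM Y Δ) (G : SimpleGraph (Fin n)) where
  state : Fin n → Y ⊕ A.Z
  sent : Fin n → Fin Δ → List A.M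
  received : ∀ u, Fin (deg G u) → List A.M

/-- The run of the simulation. -/
noncomputable def run (A : DSM Y Δ) (G : SimpleGraph (Fin n)) (hG : ∀ v, deg G v ≤ Δ)
    (pn : PortNumbering G) : ℕ → Config A G
  | 0 =>
    { state := fun u => A.z₀ ⟨deg G u, Nat.lt_succ_of_le (hG u)⟩
      sent := fun _ _ => []
      received := fun _ _ => [] }
  | t + 1 =>
    let c := run A G hG pn t
    let s := fun v j => A.μ' (c.state v) j :: c.sent v j
    let g := fun u => extendHistories (c.received u) (Finset.univ.val.map (incoming hG pn s u))
    { state := fun u => A.δ' (c.state u) (pad Δ A.m₀ fun k => (g u k).headD A.m₀)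
      sent := s
      received := g }

variable (A : DSM Y Δ) (G : SimpleGraph (Fin n)) (hG : ∀ v, deg G v ≤ Δ) (pn : PortNumbering G)

theorem run_received (t : ℕ) (u : Fin n) :
    Finset.univ.val.map ((run A G hG pn t).received u) =
      Finset.univ.val.map (incoming hG pn (run A G hG pn t).sent u) := by
  induction t with
  | zero => rfl
  | succ t ih => exact (extendHistories_spec ih.symm).2

theorem run_received_tail (t : ℕ) (u : Fin n) (k : Fin (deg G u)) :
    ((run A G hG pn (t + 1)).received u k).tail = (run A G hG pn t).received u k :=
  (extendHistories_spec (run_received A G hG pn t u).symm).1 k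

theorem exec_toMultiset (t : ℕ) (u : Fin n) :
    exec A.toMultiset G hG pn t u = ((run A G hG pn t).state u).map id
      fun z => (z, ⟨deg G u, (run A G hG pn t).received u⟩, (run A G hG pn t).sent u) := by
  induction t generalizing u with
  | zero => rfl
  | succ t ih =>
    obtain ⟨m, hm⟩ : ∃ m : Fin n → Fin Δ → Option (List A.M),
        m = fun v => A.toMultiset.μ' (exec A.toMultiset G hG pn t v) := ⟨_, rfl⟩
    have hmsg (v : Fin n) (j : Fin Δ) : m v j = some ((run A G hG pn (t + 1)).sent v j) ∨
        m v j = none ∧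
          (run A G hG pn (t + 1)).sent v j = A.m₀ :: (run A G hG pn t).sent v j := by
      simp only [hm, ih, run]
      cases (run A G hG pn t).state v with
      | inl y => exact Or.inr ⟨rfl, rfl⟩
      | inr z => exact Or.inl rfl
    have hreceived : (run A G hG pn (t + 1)).received u =
        extendHistories ((run A G hG pn t).received u)
          (complete A.m₀ (Finset.univ.val.map ((run A G hG pn t).received u))
            ((List.ofFn (pad Δ none (incoming hG pn m u)) :
              Multiset (Option (List A.M))).filterMap id)) := by
      rw [filterMap_ofFn_pad_none (hG u),
        congrArg (complete A.m₀) (run_received A G hG pn t u),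
        complete_filterMap A.m₀ (incoming hG pn (run A G hG pn (t + 1)).sent u)
          (incoming hG pn (run A G hG pn t).sent u) (incoming hG pn m u)
          (fun _ => rfl) (fun _ => hmsg _ _)]
      rfl
    have hstate : (run A G hG pn (t + 1)).state u = A.δ' ((run A G hG pn t).state u)
        (pad Δ A.m₀ fun k => ((run A G hG pn (t + 1)).received u k).headD A.m₀) := rfl
    have hsent : (run A G hG pn (t + 1)).sent u = fun j =>
        A.μ' ((run A G hG pn t).state u) j :: (run A G hG pn t).sent u j := rfl
    rw [exec_succ_s4, ← hm, ih u, hstate, hsent, hreceived]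
    cases (run A G hG pn t).state u <;> rfl

/-- The simulation up to time `T` is an execution of `A` for a suitable port numbering. -/
theorem exists_exec_eq_run (T : ℕ) :
    ∃ pn' : PortNumbering G, ∀ u, exec A G hG pn' T u = (run A G hG pn T).state u := by
  choose σ hσ using fun u =>
    exists_perm_of_map_univ_eq (run_received A G hG pn T u)
  have hreceived : ∀ t ≤ T, ∀ u k, (run A G hG pn t).received u k =
      incoming hG (pn.permute σ) (run A G hG pn t).sent u k := by
    intro t ht
    induction ht using Nat.decreasingInduction with
    | self => exact fun u k => hσ u k
    | of_succ t _ ih =>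
      intro u k
      rw [← run_received_tail, ih]
      rfl
  refine ⟨pn.permute σ, ?_⟩
  suffices h : ∀ t ≤ T, ∀ u, exec A G hG (pn.permute σ) t u = (run A G hG pn t).state u from
    h T le_rfl
  intro t
  induction t with
  | zero => exact fun _ _ => rfl
  | succ t ih =>
    intro ht u
    have hfun := funext (ih (Nat.le_of_succ_le ht))
    have hu := funext (hreceived (t + 1) ht u)
    rw [exec_succ_s4, hfun]
    change _ = A.δ' _ (pad Δ A.m₀ fun k => ((run A G hG pn (t + 1)).received u k).headD A.m₀)
    rw [hu]
    rfl

end Simulation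

/-- Theorem: a Vector algorithm can be simulated by a Multiset algorithm in the same time. -/
theorem vector_to_multiset {Y : Type} [Fintype Y] (P : GraphProblem Y) (T : ℕ → ℕ → ℕ)
    (A : ∀ Δ : ℕ, DSM Y Δ) (hsolves : SolvesInTime A P T) :
    ∃ B : ∀ Δ : ℕ, DSM Y Δ, (∀ Δ, (B Δ).InMultiset) ∧ SolvesInTime B P T := by
  refine ⟨fun Δ => (A Δ).toMultiset, fun Δ => (A Δ).toMultiset_inMultiset, ?_⟩
  intro Δ n G hG pn
  obtain ⟨pn', hpn'⟩ := exists_exec_eq_run (A Δ) G hG pn (T Δ n)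
  obtain ⟨S, hS, hout⟩ := hsolves Δ n G hG pn'
  refine ⟨S, hS, fun u => ?_⟩
  rw [exec_toMultiset, ← hpn', hout]
  rfl

end Weak
end

section
/- Let Π be the graph problem with outputs Y={0,1} defined by: if G is a k-star for some k>1 (i.e., V={c,v₁,…,v_k} and E={{c,v_i}: i=1,…,k}), then S∈Π(G) iff S(c)=0 and there is exactly one index j with S(v_j)=1 (and S(v_i)=0 for i≠j); if G is not a star, then Π(G) contains all functions S:V→{0,1}. Then Π∈SV(1) but Π∉VB. -/
namespace Weak
/-- The problem of selecting a leaf in a star: on any k-star (k > 1) with centre c,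
the centre outputs 0 and exactly one leaf outputs 1; all other graphs are unrestricted. -/
def starProblem : GraphProblem Bool := fun n G =>
  { S | ∀ c : Fin n,
      (2 < n ∧ ∀ u v : Fin n, G.Adj u v ↔ ((u = c ∨ v = c) ∧ u ≠ v)) →
      (S c = false ∧ ∃! v : Fin n, v ≠ c ∧ S v = true) }

/-- Number the ports of `u` by an enumeration of its neighbours, and send the port of `u` towards
`v` to the port of `v` towards `u`. -/
noncomputable def PortNumbering.ofNeighbors {n : ℕ} (G : SimpleGraph (Fin n)) :
    PortNumbering G where
  p := ((Equiv.sigmaCongrRight fun v => (Finite.equivFin {u : Fin n // G.Adj v u}).symm).trans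
      ⟨fun q => ⟨q.2.1, q.1, q.2.2.symm⟩, fun q => ⟨q.2.1, q.1, q.2.2.symm⟩,
        fun _ => rfl, fun _ => rfl⟩).trans
    (Equiv.sigmaCongrRight fun v => Finite.equivFin {u : Fin n // G.Adj v u})
  adj u v := by
    constructor
    · rintro ⟨i, rfl⟩
      exact ((Finite.equivFin {w : Fin n // G.Adj u w}).symm i).2
    · intro h
      refine ⟨Finite.equivFin {w : Fin n // G.Adj u w} ⟨v, h⟩, ?_⟩
      change ((Finite.equivFin {w : Fin n // G.Adj u w}).symm _).1 = v
      rw [Equiv.symm_apply_apply]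

theorem PortNumbering.adj_symm {n : ℕ} {G : SimpleGraph (Fin n)} (pn : PortNumbering G)
    (q : Port G) : G.Adj (pn.p.symm q).1 q.1 :=
  (pn.adj _ _).1 ⟨(pn.p.symm q).2, by simp⟩

/-- `G` is a star with at least two leaves, centred at `c`. -/
def IsStar {n : ℕ} (G : SimpleGraph (Fin n)) (c : Fin n) : Prop :=
  2 < n ∧ ∀ u v : Fin n, G.Adj u v ↔ ((u = c ∨ v = c) ∧ u ≠ v)

namespace IsStar

variable {n : ℕ} {G : SimpleGraph (Fin n)} {c v : Fin n}

theorem eq_center (h : IsStar G c) (hv : v ≠ c) {u : Fin n} (hu : G.Adj v u) : u = c :=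
  ((h.2 v u).1 hu).1.resolve_left hv

theorem deg_leaf (h : IsStar G c) (hv : v ≠ c) : deg G v = 1 := by
  have hc : G.Adj v c := (h.2 v c).2 ⟨Or.inr rfl, hv⟩
  rw [deg, Nat.card_eq_one_iff_exists]
  exact ⟨⟨c, hc⟩, fun u => Subtype.ext (h.eq_center hv u.2)⟩

theorem deg_center (h : IsStar G c) : deg G c = n - 1 := by
  have : ∀ u, G.Adj c u ↔ u ≠ c := fun u => by simp [h.2, eq_comm]
  simp [deg, this]

end IsStar

/-- The machine in which every node announces each port number through that port, and a node of
degree one outputs `true` if it hears the first port number. -/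
def firstPortMachine (Δ : ℕ) : DSM Bool Δ where
  Z := ℕ
  z₀ d := Sum.inr d
  M := Option ℕ
  m₀ := none
  μ _ i := some i
  δ z a := open Classical in Sum.inl (decide (z = 1 ∧ some 0 ∈ Set.range a))

theorem firstPortMachine_inSet (Δ : ℕ) : (firstPortMachine Δ).InSet := by
  intro z a b h
  refine congrArg Sum.inl (decide_eq_decide.2 (and_congr_right fun _ => ?_))
  exact Set.ext_iff.1 h (some (0 : ℕ))

open Classical in
theorem exec_firstPortMachine {Δ n : ℕ} (G : SimpleGraph (Fin n)) (hG : ∀ v, deg G v ≤ Δ)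
    (pn : PortNumbering G) (u : Fin n) :
    exec (firstPortMachine Δ) G hG pn 1 u = Sum.inl (decide (deg G u = 1 ∧
      ∃ i : Fin (deg G u), ((pn.p.symm ⟨u, i⟩).2 : ℕ) = 0)) := by
  simp only [exec, firstPortMachine, DSM.δ', DSM.μ']
  congr 2
  refine propext (and_congr_right fun _ => ⟨?_, ?_⟩)
  · rintro ⟨k, hk⟩
    dsimp only at hk
    split_ifs at hk with h
    exact ⟨⟨k, h⟩, Option.some.inj hk⟩
  · rintro ⟨i, hi⟩
    refine ⟨⟨i, i.2.trans_le (hG u)⟩, ?_⟩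
    simp [hi]

theorem SV1_starProblem : SV1 starProblem := by
  classical
  refine ⟨firstPortMachine, firstPortMachine_inSet, fun _ => 1, fun Δ n G hG pn =>
    ⟨_, fun c hc => ?_, exec_firstPortMachine G hG pn⟩⟩
  have hstar : IsStar G c := hc
  have hn : 2 < n := hstar.1
  have hdc := hstar.deg_center
  refine ⟨decide_eq_false fun h => by omega, ?_⟩
  let q : Port G := ⟨c, ⟨0, by omega⟩⟩
  have hq : G.Adj c (pn.p q).1 := by simpa using pn.adj_symm (pn.p q)
  have hleaf : (pn.p q).1 ≠ c := hq.ne'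
  refine ⟨(pn.p q).1, ⟨hleaf, decide_eq_true ⟨hstar.deg_leaf hleaf, (pn.p q).2, ?_⟩⟩, ?_⟩
  · change ((pn.p.symm (pn.p q)).2 : ℕ) = 0
    rw [Equiv.symm_apply_apply]
  · rintro v ⟨hv, hS⟩
    obtain ⟨-, i, hi⟩ := of_decide_eq_true hS
    have hvc : (pn.p.symm ⟨v, i⟩).1 = c := hstar.eq_center hv (pn.adj_symm ⟨v, i⟩).symm
    have hsymm : pn.p.symm ⟨v, i⟩ = q := by
      generalize pn.p.symm ⟨v, i⟩ = r at hvc hi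
      obtain ⟨w, j⟩ := r
      obtain rfl : w = c := hvc
      exact congrArg (Sigma.mk w) (Fin.ext hi)
    rw [← hsymm, Equiv.apply_symm_apply]

theorem DSM.InBroadcast.μ'_eq {Y : Type} {Δ : ℕ} {A : DSM Y Δ} (hA : A.InBroadcast)
    (x : Y ⊕ A.Z) (i j : Fin Δ) : A.μ' x i = A.μ' x j := by
  cases x with
  | inl y => rfl
  | inr z => exact hA z i j

/-- A broadcasting machine cannot tell apart the leaves of a star. -/
theorem IsStar.exec_leaf_eq {Y : Type} {Δ n : ℕ} {A : DSM Y Δ} (hA : A.InBroadcast)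
    {G : SimpleGraph (Fin n)} {c : Fin n} (h : IsStar G c) (hG : ∀ v, deg G v ≤ Δ)
    (pn : PortNumbering G) {v w : Fin n} (hv : v ≠ c) (hw : w ≠ c) (t : ℕ) :
    exec A G hG pn t v = exec A G hG pn t w := by
  have hdeg : deg G v = deg G w := (h.deg_leaf hv).trans (h.deg_leaf hw).symm
  induction t with
  | zero => simp only [exec, hdeg]
  | succ t ih =>
    simp only [exec, ih]
    congr 1
    funext k
    by_cases hk : (k : ℕ) < deg G v
    · have hk' : (k : ℕ) < deg G w := hdeg ▸ hk
      have hvw : (pn.p.symm ⟨v, ⟨k, hk⟩⟩).1 = (pn.p.symm ⟨w, ⟨k, hk'⟩⟩).1 :=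
        (h.eq_center hv (pn.adj_symm ⟨v, ⟨k, hk⟩⟩).symm).trans
          (h.eq_center hw (pn.adj_symm ⟨w, ⟨k, hk'⟩⟩).symm).symm
      rw [dif_pos hk, dif_pos hk']
      exact (hA.μ'_eq _ _ k).trans
        ((congrArg (fun x => A.μ' (exec A G hG pn t x) k) hvw).trans (hA.μ'_eq _ k _))
    · rw [dif_neg hk, dif_neg (hdeg ▸ hk)]

theorem not_VB_starProblem : ¬ VB starProblem := by
  rintro ⟨A, hA, T, hT⟩
  let G : SimpleGraph (Fin 3) :=
    { Adj := fun u v => (u = 0 ∨ v = 0) ∧ u ≠ v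
      symm := ⟨fun _ _ h => ⟨h.1.symm, h.2.symm⟩⟩
      loopless := ⟨fun _ h => h.2 rfl⟩ }
  have hstar : IsStar G 0 := ⟨by norm_num, fun _ _ => Iff.rfl⟩
  have hG : ∀ v, deg G v ≤ 3 := fun v =>
    (Finite.card_subtype_le _).trans (Nat.card_fin 3).le
  obtain ⟨S, hS, hexec⟩ := hT 3 3 G hG (.ofNeighbors G)
  obtain ⟨-, v, ⟨hv, hSv⟩, huniq⟩ := hS 0 hstar
  have hleaf : ∀ w : Fin 3, w ≠ 0 → w = v := fun w hw => huniq w ⟨hw, by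
    have := hstar.exec_leaf_eq (hA 3) hG (.ofNeighbors G) hw hv (T 3 3)
    rw [hexec, hexec] at this
    rw [Sum.inl.inj this, hSv]⟩
  have : (1 : Fin 3) = 2 := (hleaf 1 (by decide)).trans (hleaf 2 (by decide)).symm
  exact absurd this (by decide)

/-- The star problem is in SV(1) but not in VB. -/
theorem starProblem_SV1_not_VB : SV1 starProblem ∧ ¬ VB starProblem :=
  ⟨SV1_starProblem, not_VB_starProblem⟩
end Weak
end
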